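/- Let m ∈ (1,2] and β ∈ (1, 1+m]. For every u ∈ {0,1}^ℕ, u ∈ U_β(m) if and only if 0u ∈ U_β(m), where 0u denotes the sequence u prefixed by the letter 0. -/

import Mathlib

/-- `π_β(u)` for a binary sequence `u = u₁u₂⋯` (indexed from 0). -/
noncomputable def piB (β : ℝ) (u : ℕ → Bool) : ℝ :=
  ∑' k : ℕ, (if u k then (1 : ℝ) else 0) / β ^ (k + 1)

/-- `π_β(u)` for a real digit sequence. -/
noncomputable def piR (β : ℝ) (u : ℕ → ℝ) : ℝ := ∑' k : ℕ, u k / β ^ (k + 1)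

/-- A binary sequence viewed as a real digit sequence. -/
def bR (u : ℕ → Bool) : ℕ → ℝ := fun k => if u k then 1 else 0

/-- `U_β(A)`: sequences with digits in `A` whose `π_β`-value has no other expansion over `A`. -/
def Uset (β : ℝ) (A : Set ℝ) : Set (ℕ → ℝ) :=
  {u | (∀ k, u k ∈ A) ∧ ∀ v : ℕ → ℝ, (∀ k, v k ∈ A) → v ≠ u → piR β v ≠ piR β u}

/-- `𝓛(m) = inf {β > 1 : U_β(m) ∩ {0,1}^ℕ is uncountable}`. -/
noncomputable def Lval (m : ℝ) : ℝ :=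
  sInf {β : ℝ | 1 < β ∧ ¬ (Uset β {0, 1, m} ∩ {v | ∃ u : ℕ → Bool, v = bR u}).Countable}

/-- The shift orbit `O(u)` of an infinite binary word. -/
def orbit (u : ℕ → Bool) : Set (ℕ → Bool) := {v | ∃ k : ℕ, v = fun i => u (i + k)}

/-- Suffixes of `u` preceded by the letter `1`. -/
def orbit1 (u : ℕ → Bool) : Set (ℕ → Bool) :=
  {v | ∃ k : ℕ, u k = true ∧ v = fun i => u (i + k + 1)}

/-- Suffixes of `u` preceded by the letter `0`. -/
def orbit0 (u : ℕ → Bool) : Set (ℕ → Bool) :=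
  {v | ∃ k : ℕ, u k = false ∧ v = fun i => u (i + k + 1)}

open Classical in
/-- The lexicographic supremum of a set of binary sequences (greedy construction);
`⊥ = 0̄` for the empty set. -/
noncomputable def lexSupSeq (S : Set (ℕ → Bool)) : ℕ → Bool
  | n => decide (∃ u ∈ S, (∀ i, i < n → u i = lexSupSeq S i) ∧ u n = true)
  termination_by n => n

open Classical in
/-- The lexicographic infimum of a set of binary sequences (greedy construction);
`⊤ = 1̄` for the empty set. -/
noncomputable def lexInfSeq (S : Set (ℕ → Bool)) : ℕ → Bool
  | n => decide (¬ ∃ u ∈ S, (∀ i, i < n → u i = lexInfSeq S i) ∧ u n = false)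
  termination_by n => n

/-- `sup O(u)`, the lexicographically largest limit of suffixes of `u`. -/
noncomputable def supO (u : ℕ → Bool) : ℕ → Bool := lexSupSeq (orbit u)
/-- `inf O(u)`. -/
noncomputable def infO (u : ℕ → Bool) : ℕ → Bool := lexInfSeq (orbit u)
/-- `sup₀(u)`, the supremum of the suffixes preceded by `0`. -/
noncomputable def sup0 (u : ℕ → Bool) : ℕ → Bool := lexSupSeq (orbit0 u)
/-- `inf₁(u)`, the infimum of the suffixes preceded by `1`. -/
noncomputable def inf1 (u : ℕ → Bool) : ℕ → Bool := lexInfSeq (orbit1 u)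

/-- Strict lexicographic order on infinite binary words. -/
def lexLt (u v : ℕ → Bool) : Prop := ∃ n, (∀ i, i < n → u i = v i) ∧ u n < v n
/-- Lexicographic order on infinite binary words. -/
def lexLe (u v : ℕ → Bool) : Prop := lexLt u v ∨ u = v

/-- `f_u(m)`: the unique `β ≥ 1` with `β·π_β(sup O(u)) = m`. -/
noncomputable def fVal (u : ℕ → Bool) (m : ℝ) : ℝ :=
  sInf {β : ℝ | 1 ≤ β ∧ β * piB β (supO u) = m}

/-- `g_u(m)`: the unique `β > 1` with `(β-1)(1+π_β(inf O(u))) = m`. -/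
noncomputable def gVal (u : ℕ → Bool) (m : ℝ) : ℝ :=
  sInf {β : ℝ | 1 < β ∧ (β - 1) * (1 + piB β (infO u)) = m}

/-- `μ_u`: the unique `m ∈ (1,2]` with `f_u(m) = g_u(m)`. -/
noncomputable def muVal (u : ℕ → Bool) : ℝ :=
  sInf {m : ℝ | 1 < m ∧ m ≤ 2 ∧ fVal u m = gVal u m}

/-- `u` contains at least two ones. -/
def TwoOnes (u : ℕ → Bool) : Prop := ∃ k l, k < l ∧ u k = true ∧ u l = true

/-- The substitution `L : 0 ↦ 0, 1 ↦ 01` (with `0 = false`, `1 = true`). -/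
def Lsub : Bool → List Bool := fun b => if b then [false, true] else [false]
/-- The substitution `M : 0 ↦ 01, 1 ↦ 10`. -/
def Msub : Bool → List Bool := fun b => if b then [true, false] else [false, true]
/-- The substitution `R : 0 ↦ 01, 1 ↦ 1`. -/
def Rsub : Bool → List Bool := fun b => if b then [true] else [false, true]
/-- The identity substitution. -/
def idSub : Bool → List Bool := fun b => [b]
/-- Composition of substitutions: `compSub σ τ = σ ∘ τ` (apply `τ` first). -/
def compSub (σ τ : Bool → List Bool) : Bool → List Bool := fun b => (τ b).flatMap σ

/-- The monoid `{L,M,R}*` generated by the three substitutions. -/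
def LMRstar : Set (Bool → List Bool) :=
  {σ | ∃ l : List (Bool → List Bool),
    (∀ τ ∈ l, τ = Lsub ∨ τ = Msub ∨ τ = Rsub) ∧ σ = l.foldr compSub idSub}

/-- A substitution applied to an infinite word, `σ(u₁)σ(u₂)⋯`. -/
noncomputable def substApply (σ : Bool → List Bool) (u : ℕ → Bool) : ℕ → Bool := fun n =>
  let k := sSup {k : ℕ | (∑ i ∈ Finset.range k, (σ (u i)).length) ≤ n}
  (σ (u k)).getD (n - ∑ i ∈ Finset.range k, (σ (u i)).length) false

/-- `u` is a limit word of the sequence of substitutions `σseq`. -/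
def IsLimitWord (σseq : ℕ → Bool → List Bool) (u : ℕ → Bool) : Prop :=
  ∃ useq : ℕ → ℕ → Bool, useq 0 = u ∧ ∀ n, useq n = substApply (σseq n) (useq (n + 1))

/-- Primitivity of a sequence of substitutions in `{L,M,R}^ℕ`: no tail is constantly `L`
and no tail is constantly `R`. -/
def PrimitiveSeq (σseq : ℕ → Bool → List Bool) : Prop :=
  (¬ ∃ k, ∀ n, k ≤ n → σseq n = Lsub) ∧ ¬ ∃ k, ∀ n, k ≤ n → σseq n = Rsub

/-- `S_{L,M,R}`: the set of limit words of primitive sequences of substitutions. -/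
def Sset : Set (ℕ → Bool) :=
  {u | ∃ σseq : ℕ → Bool → List Bool,
    (∀ n, σseq n = Lsub ∨ σseq n = Msub ∨ σseq n = Rsub) ∧
    PrimitiveSeq σseq ∧ IsLimitWord σseq u}

/-- The word `1 0̄ = 1000⋯`. -/
def w10bar : ℕ → Bool := fun n => decide (n = 0)
/-- The word `0 1̄ = 0111⋯`. -/
def w01bar : ℕ → Bool := fun n => decide (n ≠ 0)
/-- The word `01 0̄ = 01000⋯`. -/
def w010bar : ℕ → Bool := fun n => decide (n = 1)
/-- The word `10 1̄ = 10111⋯`. -/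
def w101bar : ℕ → Bool := fun n => decide (n ≠ 1)
/-- The word `0̄`. -/
def w0bar : ℕ → Bool := fun _ => false
/-- The word `1̄`. -/
def w1bar : ℕ → Bool := fun _ => true

/-- Prepend a letter to an infinite word. -/
def consB (b : Bool) (u : ℕ → Bool) : ℕ → Bool := fun n =>
  match n with
  | 0 => b
  | Nat.succ k => u k

/-- Prepend a finite word to an infinite word. -/
def appendW (w : List Bool) (v : ℕ → Bool) : ℕ → Bool := fun n =>
  if n < w.length then w.getD n false else v (n - w.length)

/-- Prepend a letter to a real digit sequence. -/
def consR (d : ℝ) (v : ℕ → ℝ) : ℕ → ℝ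
  | 0 => d
  | n + 1 => v n

lemma consR_mem {A : Set ℝ} {d : ℝ} {v : ℕ → ℝ} (hd : d ∈ A) (hv : ∀ k, v k ∈ A) (k : ℕ) :
    consR d v k ∈ A := by
  cases k with
  | zero => exact hd
  | succ k => exact hv k

lemma consR_head_tail (v : ℕ → ℝ) : consR (v 0) (fun k => v (k + 1)) = v := by
  funext k
  cases k <;> rfl

lemma bR_consB_false (u : ℕ → Bool) : bR (consB false u) = consR 0 (bR u) := by
  funext k
  cases k with
  | zero => simp [bR, consB, consR]
  | succ k => rfl

lemma hasSum_const_div_pow {β : ℝ} (hβ : 1 < β) (c : ℝ) :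
    HasSum (fun k : ℕ => c / β ^ (k + 1)) (c / (β - 1)) := by
  have h0 : 0 < β := by linarith
  have h1 : β - 1 ≠ 0 := by linarith
  have h := (hasSum_geometric_of_lt_one (inv_nonneg.2 h0.le) (inv_lt_one_of_one_lt₀ hβ)).mul_left
    (c / β)
  have hval : c / β * (1 - β⁻¹)⁻¹ = c / (β - 1) := by
    have h2 : 1 - β⁻¹ = (β - 1) / β := by field_simp
    rw [h2]
    field_simp
  rw [hval] at h
  have hterm : ∀ k : ℕ, c / β * β⁻¹ ^ k = c / β ^ (k + 1) := fun k => by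
    rw [inv_pow, pow_succ]
    field_simp
  simpa only [hterm] using h

lemma summable_piR {β M : ℝ} (hβ : 1 < β) {v : ℕ → ℝ} (hv : ∀ k, v k ∈ Set.Icc 0 M) :
    Summable (fun k : ℕ => v k / β ^ (k + 1)) := by
  have h0 : 0 < β := by linarith
  refine Summable.of_nonneg_of_le (fun k => div_nonneg (hv k).1 (by positivity)) (fun k => ?_)
    (hasSum_const_div_pow hβ M).summable
  have := (hv k).2
  gcongr

lemma piR_mem_Icc {β M : ℝ} (hβ : 1 < β) {v : ℕ → ℝ} (hv : ∀ k, v k ∈ Set.Icc 0 M) :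
    piR β v ∈ Set.Icc 0 (M / (β - 1)) := by
  have h0 : 0 < β := by linarith
  refine ⟨tsum_nonneg fun k => div_nonneg (hv k).1 (by positivity), ?_⟩
  refine hasSum_le (fun k => ?_) (summable_piR hβ hv).hasSum (hasSum_const_div_pow hβ M)
  have := (hv k).2
  gcongr

lemma piR_consR {β M : ℝ} (hβ : 1 < β) (d : ℝ) {v : ℕ → ℝ} (hv : ∀ k, v k ∈ Set.Icc 0 M) :
    piR β (consR d v) = (d + piR β v) / β := by
  have h0 : β ≠ 0 := by linarith
  have hs : ∀ k : ℕ, consR d v (k + 1) / β ^ (k + 1 + 1) = v k / β ^ (k + 1) / β := by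
    intro k
    rw [pow_succ β (k + 1), div_div]
    rfl
  have hsum : Summable (fun k : ℕ => consR d v k / β ^ (k + 1)) := by
    rw [← summable_nat_add_iff 1]
    simp only [hs]
    exact (summable_piR hβ hv).div_const β
  unfold piR
  rw [hsum.tsum_eq_zero_add]
  simp only [hs, tsum_div_const]
  simp [consR, add_div]

/-- If every point `y` of `[0, C]` admits a digit `d ∈ A` with `β y - d ∈ [0, C]`, then every
point of `[0, C]` has a `β`-expansion over `A`. -/
lemma exists_piR_eq {β C : ℝ} (hβ : 1 < β) {A : Set ℝ}
    (hstep : ∀ y ∈ Set.Icc 0 C, ∃ d ∈ A, β * y - d ∈ Set.Icc 0 C)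
    (hA : ∃ M, A ⊆ Set.Icc 0 M) {y : ℝ} (hy : y ∈ Set.Icc 0 C) :
    ∃ v : ℕ → ℝ, (∀ k, v k ∈ A) ∧ piR β v = y := by
  have h0 : 0 < β := by linarith
  obtain ⟨M, hM⟩ := hA
  choose! d hdA hdC using hstep
  let r : ℕ → ℝ := fun n => (fun z => β * z - d z)^[n] y
  have hr : ∀ n, r n ∈ Set.Icc 0 C := by
    intro n
    induction n with
    | zero => exact hy
    | succ n ih =>
      simp only [r, Function.iterate_succ_apply']
      exact hdC _ ih
  have hrs : ∀ n, r (n + 1) = β * r n - d (r n) := fun n => by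
    simp only [r, Function.iterate_succ_apply']
  have hv : ∀ k, d (r k) ∈ A := fun k => hdA _ (hr k)
  refine ⟨fun k => d (r k), hv, ?_⟩
  have hpart : ∀ n, ∑ k ∈ Finset.range n, d (r k) / β ^ (k + 1) = y - r n / β ^ n := by
    intro n
    induction n with
    | zero => simp [r]
    | succ n ih =>
      rw [Finset.sum_range_succ, ih, hrs]
      field_simp
      ring
  have hlim : Filter.Tendsto (fun n => r n / β ^ n) Filter.atTop (nhds 0) := by
    have hC : Filter.Tendsto (fun n : ℕ => C / β ^ n) Filter.atTop (nhds 0) :=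
      (tendsto_pow_atTop_atTop_of_one_lt hβ).const_div_atTop C
    refine squeeze_zero (fun n => div_nonneg (hr n).1 (by positivity)) (fun n => ?_) hC
    have := (hr n).2
    gcongr
  have h1 := (summable_piR hβ fun k => hM (hv k)).hasSum.tendsto_sum_nat
  have h2 : Filter.Tendsto (fun n => y - r n / β ^ n) Filter.atTop (nhds (y - 0)) :=
    tendsto_const_nhds.sub hlim
  simp only [hpart] at h1
  rw [piR, tendsto_nhds_unique h1 h2, sub_zero]

lemma digits_subset_Icc {m : ℝ} (hm : 1 < m) : ({0, 1, m} : Set ℝ) ⊆ Set.Icc 0 m := by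
  rintro d (rfl | rfl | rfl) <;> constructor <;> linarith

lemma exists_expansion {m β : ℝ} (hm : m ∈ Set.Ioc (1 : ℝ) 2) (hβ : β ∈ Set.Ioc (1 : ℝ) (1 + m))
    {y : ℝ} (hy : y ∈ Set.Icc 0 (m / (β - 1))) :
    ∃ v : ℕ → ℝ, (∀ k, v k ∈ ({0, 1, m} : Set ℝ)) ∧ piR β v = y := by
  obtain ⟨hm1, hm2⟩ := hm
  obtain ⟨hβ1, hβ2⟩ := hβ
  have hC : 1 ≤ m / (β - 1) := by rw [le_div_iff₀] <;> linarith
  have hCβ : β * (m / (β - 1)) = m / (β - 1) + m := by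
    have : β - 1 ≠ 0 := by linarith
    field_simp
    ring
  refine exists_piR_eq hβ1 (fun z hz => ?_) ⟨m, digits_subset_Icc hm1⟩ hy
  have hz0 : 0 ≤ β * z := mul_nonneg (by linarith) hz.1
  have hz1 : β * z ≤ m / (β - 1) + m := by
    rw [← hCβ]
    exact mul_le_mul_of_nonneg_left hz.2 (by linarith)
  rcases lt_or_ge (β * z) 1 with h | h
  · exact ⟨0, by simp, by constructor <;> linarith⟩
  rcases lt_or_ge (β * z) m with h' | h'
  · exact ⟨1, by simp, by constructor <;> linarith⟩
  · exact ⟨m, by simp, by constructor <;> linarith⟩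

/-- A unique expansion cannot have its first digit changed. -/
lemma notMem_Icc_of_consR_mem_Uset {m β : ℝ} (hm : m ∈ Set.Ioc (1 : ℝ) 2)
    (hβ : β ∈ Set.Ioc (1 : ℝ) (1 + m)) {c d : ℝ} {w : ℕ → ℝ}
    (hu : consR c w ∈ Uset β {0, 1, m}) (hd : d ∈ ({0, 1, m} : Set ℝ)) (hdc : d ≠ c) :
    c + piR β w - d ∉ Set.Icc 0 (m / (β - 1)) := by
  intro hy
  obtain ⟨v, hv, hvy⟩ := exists_expansion hm hβ hy
  have hw : ∀ k, w k ∈ ({0, 1, m} : Set ℝ) := fun k => hu.1 (k + 1)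
  refine hu.2 (consR d v) (consR_mem hd hv) (fun h => hdc (congrFun h 0)) ?_
  rw [piR_consR hβ.1 d fun k => digits_subset_Icc hm.1 (hv k),
    piR_consR hβ.1 c fun k => digits_subset_Icc hm.1 (hw k), hvy]
  ring

/-- Binary sequences in `U_β(m)` have value less than `1`. -/
lemma piR_bR_lt_one {m β : ℝ} (hm : m ∈ Set.Ioc (1 : ℝ) 2) (hβ : β ∈ Set.Ioc (1 : ℝ) (1 + m))
    {u : ℕ → Bool} (hu : bR u ∈ Uset β {0, 1, m}) : piR β (bR u) < 1 := by
  obtain ⟨hm1, hm2⟩ := id hm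
  obtain ⟨hβ1, hβ2⟩ := id hβ
  set w : ℕ → ℝ := fun k => bR u (k + 1)
  have hw : ∀ k, w k ∈ Set.Icc 0 m := fun k => digits_subset_Icc hm1 (hu.1 (k + 1))
  have hwI := piR_mem_Icc hβ1 hw
  rw [← consR_head_tail (bR u)] at hu ⊢
  rw [piR_consR hβ1 _ hw, div_lt_one (by linarith)]
  cases h : u 0 with
  | false =>
    have hb : bR u 0 = 0 := by simp [bR, h]
    rw [hb] at hu ⊢
    by_contra! hx
    refine notMem_Icc_of_consR_mem_Uset hm hβ hu (d := 1) (by simp) one_ne_zero ⟨?_, ?_⟩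
    · linarith
    · linarith [hwI.2]
  | true =>
    have hb : bR u 0 = 1 := by simp [bR, h]
    rw [hb] at hu ⊢
    have hlt_m : 1 + piR β w < m := by
      by_contra! hx
      exact notMem_Icc_of_consR_mem_Uset hm hβ hu (d := m) (by simp) hm1.ne'
        ⟨by linarith, by linarith [hwI.2]⟩
    have hgt : m / (β - 1) < 1 + piR β w := by
      by_contra! hx
      exact notMem_Icc_of_consR_mem_Uset hm hβ hu (d := 0) (by simp) zero_ne_one
        ⟨by linarith [hwI.1], by linarith⟩
    have hβm : m < m * (β - 1) := (div_lt_iff₀ (by linarith)).1 (hgt.trans hlt_m)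
    nlinarith

/-- Prepending the letter `0` to a binary sequence does not change membership in `U_β(m)`. -/
theorem mem_U_iff_cons_zero (m β : ℝ) (hm : m ∈ Set.Ioc (1 : ℝ) 2)
    (hβ : β ∈ Set.Ioc (1 : ℝ) (1 + m)) (u : ℕ → Bool) :
    bR u ∈ Uset β {0, 1, m} ↔ bR (consB false u) ∈ Uset β {0, 1, m} := by
  have hA := digits_subset_Icc hm.1
  have hβ0 : β ≠ 0 := by linarith [hβ.1]
  rw [bR_consB_false]
  constructor
  · intro hu
    have hlt := piR_bR_lt_one hm hβ hu
    refine ⟨consR_mem (by simp) hu.1, fun v hv hne heq => ?_⟩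
    set w : ℕ → ℝ := fun k => v (k + 1)
    have hw : ∀ k, w k ∈ ({0, 1, m} : Set ℝ) := fun k => hv (k + 1)
    have hw0 := (piR_mem_Icc hβ.1 fun k => hA (hw k)).1
    have hv0 := hv 0
    rw [← consR_head_tail v] at heq hne
    rw [piR_consR hβ.1 _ fun k => hA (hw k), piR_consR hβ.1 _ fun k => hA (hu.1 k),
      div_left_inj' hβ0, zero_add] at heq
    rcases hv0 with h | h | h <;> rw [h] at heq hne
    · exact hu.2 w hw (fun hwu => hne (congrArg (consR 0) hwu)) (by rw [← heq, zero_add])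
    · linarith
    · linarith [hm.1]
  · intro hu
    have hbu : ∀ k, bR u k ∈ ({0, 1, m} : Set ℝ) := fun k => hu.1 (k + 1)
    refine ⟨hbu, fun v hv hne heq => ?_⟩
    refine hu.2 (consR 0 v) (consR_mem (by simp) hv)
      (fun h => hne (funext fun k => congrFun h (k + 1))) ?_
    rw [piR_consR hβ.1 _ fun k => hA (hv k), piR_consR hβ.1 _ fun k => hA (hbu k), heq]
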